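/- For every n ≥ 0 and every x ∈ X: (a) v^U_n(x,s) = v^U_n(x, s*(x)) for every integer s ≤ s*(x); (b) the map s ↦ v^U_n(x,s) is nondecreasing and convex on ℤ (i.e., v^U_n(x,s+1) − v^U_n(x,s) is nondecreasing in s); and (c) v_n(x,s) ≤ v^U_n(x,s) for every s ∈ ℤ. -/

import Mathlib

open Finset

noncomputable section

open scoped Classical

namespace InvCtrl

variable {N M : ℕ} {Z : Type*}

/-- Membership in the belief space `X ⊆ ℝ^N`. -/
def memX (N : ℕ) (x : Fin N → ℝ) : Prop :=
  (∀ i, 0 ≤ x i) ∧ ∑ i, x i = 1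

variable [Fintype Z]

/-- `σ(d_k, z, x) = x ⬝ P(d_k, z) ⬝ 𝟙`. -/
def sigz (P : Fin M → Z → Matrix (Fin N) (Fin N) ℝ) (k : Fin M) (z : Z) (x : Fin N → ℝ) : ℝ :=
  ∑ i, x i * ∑ j, P k z i j

/-- `σ(d_k, x) = ∑_z σ(d_k, z, x)`. -/
def sig (P : Fin M → Z → Matrix (Fin N) (Fin N) ℝ) (k : Fin M) (x : Fin N → ℝ) : ℝ :=
  ∑ z, sigz P k z x

/-- Posterior belief `λ(d_k, z, x) = x P(d_k, z) / σ(d_k, z, x)` (componentwise). -/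
def lam (P : Fin M → Z → Matrix (Fin N) (Fin N) ℝ) (k : Fin M) (z : Z) (x : Fin N → ℝ) :
    Fin N → ℝ :=
  fun j => (∑ i, x i * P k z i j) / sigz P k z x

/-- Single-period cost `c(y, d) = p·(d − y)⁺ + h·(y − d)⁺`. -/
def cst (p hc y dd : ℝ) : ℝ := p * max (dd - y) 0 + hc * max (y - dd) 0

/-- Expected single-period cost `L(x, y) = ∑_k σ(d_k, x) c(y, d_k)`. -/
def Lf (P : Fin M → Z → Matrix (Fin N) (Fin N) ℝ) (d : Fin M → ℤ) (p hc : ℝ)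
    (x : Fin N → ℝ) (y : ℝ) : ℝ :=
  ∑ k, sig P k x * cst p hc y (d k : ℝ)

/-- `s*(x)`: the smallest element of `{d_1, …, d_M}` at which `m ↦ L(x, d_m)` is minimized. -/
def sStar (P : Fin M → Z → Matrix (Fin N) (Fin N) ℝ) (d : Fin M → ℤ) (p hc : ℝ)
    (x : Fin N → ℝ) : ℤ :=
  sInf {t : ℤ | ∃ m : Fin M, t = d m ∧ ∀ k : Fin M, Lf P d p hc x (d m : ℝ) ≤ Lf P d p hc x (d k : ℝ)}

/-- First-order stochastic dominance `x ⪯ x'`. -/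
def sdom (x x' : Fin N → ℝ) : Prop :=
  ∀ n : Fin N, ∑ i ∈ univ.filter (fun i => n ≤ i), x i ≤ ∑ i ∈ univ.filter (fun i => n ≤ i), x' i

/-- The `i`-th standard unit vector in `ℝ^N`. -/
def eV (N : ℕ) (i : Fin N) : Fin N → ℝ := fun j => if j = i then 1 else 0

/-- Assumption A3. -/
def A3 (P : Fin M → Z → Matrix (Fin N) (Fin N) ℝ) : Prop :=
  ∀ i i' : Fin N, i ≤ i' → ∀ m : Fin M,
    ∑ k ∈ univ.filter (fun k : Fin M => m ≤ k), ∑ j, ∑ z, P k z i j ≤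
      ∑ k ∈ univ.filter (fun k : Fin M => m ≤ k), ∑ j, ∑ z, P k z i' j

/-- `A_m(x) = h ∑_{k=1}^m σ(d_k,x) − p ∑_{k=m+1}^M σ(d_k,x)` (for `m = 0, …, M`). -/
def Am (P : Fin M → Z → Matrix (Fin N) (Fin N) ℝ) (p hc : ℝ) (m : ℕ) (x : Fin N → ℝ) : ℝ :=
  hc * ∑ k ∈ univ.filter (fun k : Fin M => (k : ℕ) < m), sig P k x
    - p * ∑ k ∈ univ.filter (fun k : Fin M => m ≤ (k : ℕ)), sig P k x

/-- `B_m(x) = p ∑_{k=m+1}^M d_k σ(d_k,x) − h ∑_{k=1}^m d_k σ(d_k,x)` (for `m = 0, …, M`). -/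
def Bm (P : Fin M → Z → Matrix (Fin N) (Fin N) ℝ) (d : Fin M → ℤ) (p hc : ℝ) (m : ℕ)
    (x : Fin N → ℝ) : ℝ :=
  p * ∑ k ∈ univ.filter (fun k : Fin M => m ≤ (k : ℕ)), (d k : ℝ) * sig P k x
    - hc * ∑ k ∈ univ.filter (fun k : Fin M => (k : ℕ) < m), (d k : ℝ) * sig P k x

/-- Finite-horizon value iteration: `v_0 = 0` and
`v_{n+1}(x,s) = inf_{y ≥ s, y ∈ ℤ} [ L(x,y) + β ∑_{(d_k,z) : σ(d_k,z,x) ≠ 0} σ(d_k,z,x)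
v_n(λ(d_k,z,x), f(y,d_k)) ]`, for a general transition `f` of the inventory position. -/
def vIter (P : Fin M → Z → Matrix (Fin N) (Fin N) ℝ) (d : Fin M → ℤ) (p hc β : ℝ)
    (f : ℤ → ℤ → ℤ) : ℕ → (Fin N → ℝ) → ℤ → ℝ
  | 0, _, _ => 0
  | n + 1, x, s =>
    sInf {r : ℝ | ∃ y : ℤ, s ≤ y ∧
      r = Lf P d p hc x (y : ℝ) + β * ∑ k, ∑ z,
        (if sigz P k z x = 0 then 0
         else sigz P k z x * vIter P d p hc β f n (lam P k z x) (f y (d k)))}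

/-- The lower-bound iteration: `v^L_0 = 0` and
`v^L_{n+1}(x) = L(x, s*(x)) + β ∑_{(d_k,z) : σ ≠ 0} σ(d_k,z,x) v^L_n(λ(d_k,z,x))`. -/
def vLow (P : Fin M → Z → Matrix (Fin N) (Fin N) ℝ) (d : Fin M → ℤ) (p hc β : ℝ) :
    ℕ → (Fin N → ℝ) → ℝ
  | 0, _ => 0
  | n + 1, x =>
    Lf P d p hc x ((sStar P d p hc x : ℤ) : ℝ) + β * ∑ k, ∑ z,
      (if sigz P k z x = 0 then 0
       else sigz P k z x * vLow P d p hc β n (lam P k z x))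

/-- The upper-bound iteration (cost of the myopic "order up to `max{s*(x),s}`" policy):
`v^U_0 = 0` and, with `y(x,s) = max{s*(x),s}`,
`v^U_{n+1}(x,s) = L(x,y(x,s)) + β ∑_{(d_k,z) : σ ≠ 0} σ(d_k,z,x)
v^U_n(λ(d_k,z,x), y(x,s) − d_k)`. -/
def vUp (P : Fin M → Z → Matrix (Fin N) (Fin N) ℝ) (d : Fin M → ℤ) (p hc β : ℝ) :
    ℕ → (Fin N → ℝ) → ℤ → ℝ
  | 0, _, _ => 0
  | n + 1, x, s =>
    Lf P d p hc x ((max (sStar P d p hc x) s : ℤ) : ℝ) + β * ∑ k, ∑ z,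
      (if sigz P k z x = 0 then 0
       else sigz P k z x * vUp P d p hc β n (lam P k z x) (max (sStar P d p hc x) s - d k))

lemma sigz_nonneg (P : Fin M → Z → Matrix (Fin N) (Fin N) ℝ)
    (hPnn : ∀ k z i j, 0 ≤ P k z i j) (x : Fin N → ℝ) (hx : memX N x) (k : Fin M) (z : Z) :
    0 ≤ sigz P k z x :=
  Finset.sum_nonneg fun i _ => mul_nonneg (hx.1 i) (Finset.sum_nonneg fun j _ => hPnn k z i j)

lemma sig_nonneg (P : Fin M → Z → Matrix (Fin N) (Fin N) ℝ)
    (hPnn : ∀ k z i j, 0 ≤ P k z i j) (x : Fin N → ℝ) (hx : memX N x) (k : Fin M) :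
    0 ≤ sig P k x :=
  Finset.sum_nonneg fun z _ => sigz_nonneg P hPnn x hx k z

lemma lam_mem (P : Fin M → Z → Matrix (Fin N) (Fin N) ℝ)
    (hPnn : ∀ k z i j, 0 ≤ P k z i j) (x : Fin N → ℝ) (hx : memX N x) (k : Fin M) (z : Z)
    (h0 : sigz P k z x ≠ 0) : memX N (lam P k z x) := by
  constructor
  · intro j
    exact div_nonneg (Finset.sum_nonneg fun i _ => mul_nonneg (hx.1 i) (hPnn k z i j))
      (sigz_nonneg P hPnn x hx k z)
  · unfold lam
    rw [← Finset.sum_div, Finset.sum_comm]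
    have : ∑ i, ∑ j, x i * P k z i j = sigz P k z x := by
      unfold sigz
      simp_rw [Finset.mul_sum]
    rw [this, div_self h0]

lemma Lf_nonneg (P : Fin M → Z → Matrix (Fin N) (Fin N) ℝ) (d : Fin M → ℤ)
    (hPnn : ∀ k z i j, 0 ≤ P k z i j) (p hc : ℝ) (hp : 0 < p) (hhc : 0 < hc)
    (x : Fin N → ℝ) (hx : memX N x) (y : ℝ) : 0 ≤ Lf P d p hc x y := by
  refine Finset.sum_nonneg fun k _ => mul_nonneg (sig_nonneg P hPnn x hx k) ?_
  unfold cst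
  positivity

lemma vIter_nonneg (P : Fin M → Z → Matrix (Fin N) (Fin N) ℝ) (d : Fin M → ℤ)
    (hPnn : ∀ k z i j, 0 ≤ P k z i j) (p hc : ℝ) (hp : 0 < p) (hhc : 0 < hc)
    (β : ℝ) (hβ0 : 0 ≤ β) (f : ℤ → ℤ → ℤ) (n : ℕ) : ∀ (x : Fin N → ℝ), memX N x →
    ∀ s : ℤ, 0 ≤ vIter P d p hc β f n x s ∧ ∀ y : ℤ, 
      0 ≤ Lf P d p hc x (y : ℝ) + β * ∑ k, ∑ z,
        (if sigz P k z x = 0 then 0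
         else sigz P k z x * vIter P d p hc β f n (lam P k z x) (f y (d k))) := by
  have step : ∀ n, (∀ (x : Fin N → ℝ), memX N x → ∀ s : ℤ, 0 ≤ vIter P d p hc β f n x s) →
      ∀ (x : Fin N → ℝ), memX N x → ∀ y : ℤ, 
      0 ≤ Lf P d p hc x (y : ℝ) + β * ∑ k, ∑ z,
        (if sigz P k z x = 0 then 0
         else sigz P k z x * vIter P d p hc β f n (lam P k z x) (f y (d k))) := by
    intro n ih x hx y
    refine add_nonneg (Lf_nonneg P d hPnn p hc hp hhc x hx y) (mul_nonneg hβ0 ?_)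
    refine Finset.sum_nonneg fun k _ => Finset.sum_nonneg fun z _ => ?_
    split_ifs with h0
    · exact le_rfl
    · exact mul_nonneg (sigz_nonneg P hPnn x hx k z) (ih _ (lam_mem P hPnn x hx k z h0) _)
  have main : ∀ n, ∀ (x : Fin N → ℝ), memX N x → ∀ s : ℤ, 0 ≤ vIter P d p hc β f n x s := by
    intro n
    induction n with
    | zero => intro x _ s; simp [vIter]
    | succ n ih =>
      intro x hx s
      rw [vIter]
      apply Real.sInf_nonneg
      rintro r ⟨y, _, rfl⟩
      exact step n ih x hx y
  exact fun x hx s => ⟨main n x hx s, step n (main n) x hx⟩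

/-- Increments of the one-period cost. -/
lemma cst_step (p hc : ℝ) (y t : ℤ) :
    cst p hc ((y + 1 : ℤ) : ℝ) t - cst p hc y t = if t ≤ y then hc else -p := by
  unfold cst
  push_cast
  split_ifs with h
  · have h' : (t : ℝ) ≤ y := by exact_mod_cast h
    rw [max_eq_right (by linarith), max_eq_left (by linarith), max_eq_right (by linarith),
      max_eq_left (by linarith)]
    ring
  · have h' : (y : ℝ) + 1 ≤ t := by exact_mod_cast (by omega : y + 1 ≤ t)
    rw [max_eq_left (by linarith), max_eq_right (by linarith), max_eq_left (by linarith),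
      max_eq_right (by linarith)]
    ring

lemma cst_seg (p hc : ℝ) (a b t : ℤ) (hab : a < b) (ht : t ≤ a ∨ b ≤ t) :
    cst p hc b t - cst p hc a t = ((b : ℝ) - a) * (if t ≤ a then hc else -p) := by
  have hab' : (a : ℝ) < b := by exact_mod_cast hab
  unfold cst
  split_ifs with h
  · have h' : (t : ℝ) ≤ a := by exact_mod_cast h
    rw [max_eq_right (by linarith), max_eq_left (by linarith), max_eq_right (by linarith),
      max_eq_left (by linarith)]
    ring
  · have h' : (b : ℝ) ≤ t := by exact_mod_cast ht.resolve_left h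
    rw [max_eq_left (by linarith), max_eq_right (by linarith), max_eq_left (by linarith),
      max_eq_right (by linarith)]
    ring

lemma Lf_step (P : Fin M → Z → Matrix (Fin N) (Fin N) ℝ) (d : Fin M → ℤ) (p hc : ℝ)
    (x : Fin N → ℝ) (y : ℤ) :
    Lf P d p hc x ((y + 1 : ℤ) : ℝ) - Lf P d p hc x (y : ℝ)
      = ∑ k, sig P k x * (if d k ≤ y then hc else -p) := by
  unfold Lf
  rw [← Finset.sum_sub_distrib]
  refine Finset.sum_congr rfl fun k _ => ?_
  rw [← mul_sub, cst_step]

lemma Lf_convex (P : Fin M → Z → Matrix (Fin N) (Fin N) ℝ) (d : Fin M → ℤ)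
    (hPnn : ∀ k z i j, 0 ≤ P k z i j) (p hc : ℝ) (hp : 0 < p) (hhc : 0 < hc)
    (x : Fin N → ℝ) (hx : memX N x) (s t : ℤ) (hst : s ≤ t) :
    Lf P d p hc x ((s + 1 : ℤ) : ℝ) - Lf P d p hc x (s : ℝ) ≤
      Lf P d p hc x ((t + 1 : ℤ) : ℝ) - Lf P d p hc x (t : ℝ) := by
  rw [Lf_step, Lf_step]
  refine Finset.sum_le_sum fun k _ => mul_le_mul_of_nonneg_left ?_ (sig_nonneg P hPnn x hx k)
  split_ifs <;> first | omega | linarith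

lemma sStar_mem (P : Fin M → Z → Matrix (Fin N) (Fin N) ℝ) (d : Fin M → ℤ) (p hc : ℝ)
    (hM : 1 ≤ M) (x : Fin N → ℝ) :
    ∃ m : Fin M, sStar P d p hc x = d m ∧
      ∀ k : Fin M, Lf P d p hc x (d m : ℝ) ≤ Lf P d p hc x (d k : ℝ) := by
  haveI : Nonempty (Fin M) := ⟨⟨0, hM⟩⟩
  have hne : {t : ℤ | ∃ m : Fin M, t = d m ∧
      ∀ k : Fin M, Lf P d p hc x (d m : ℝ) ≤ Lf P d p hc x (d k : ℝ)}.Nonempty := by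
    obtain ⟨m, hm⟩ := Finite.exists_min (fun k => Lf P d p hc x (d k : ℝ))
    exact ⟨d m, m, rfl, hm⟩
  have hb : BddBelow {t : ℤ | ∃ m : Fin M, t = d m ∧
      ∀ k : Fin M, Lf P d p hc x (d m : ℝ) ≤ Lf P d p hc x (d k : ℝ)} := by
    refine (Set.finite_range d).bddBelow.mono ?_
    rintro t ⟨m, rfl, _⟩
    exact ⟨m, rfl⟩
  exact Int.csInf_mem hne hb

lemma Lf_star (P : Fin M → Z → Matrix (Fin N) (Fin N) ℝ) (d : Fin M → ℤ)
    (hPnn : ∀ k z i j, 0 ≤ P k z i j) (p hc : ℝ) (hhc : 0 < hc) (hM : 1 ≤ M)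
    (x : Fin N → ℝ) (hx : memX N x) :
    Lf P d p hc x (sStar P d p hc x : ℝ) ≤ Lf P d p hc x ((sStar P d p hc x + 1 : ℤ) : ℝ) := by
  obtain ⟨m, hm, hmin⟩ := sStar_mem P d p hc hM x
  rw [hm, ← sub_nonneg, Lf_step]
  by_cases hex : ∃ k, d m < d k
  · obtain ⟨k, hk, hkmin⟩ := Finset.exists_min_image (univ.filter fun k => d m < d k) d
      (by obtain ⟨k, hk⟩ := hex; exact ⟨k, by simpa using hk⟩)
    have hk' : d m < d k := by simpa using hk
    have hseg : Lf P d p hc x (d k : ℝ) - Lf P d p hc x (d m : ℝ)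
        = ((d k : ℝ) - d m) * ∑ j, sig P j x * (if d j ≤ d m then hc else -p) := by
      unfold Lf
      rw [← Finset.sum_sub_distrib, Finset.mul_sum]
      refine Finset.sum_congr rfl fun j _ => ?_
      rw [← mul_sub, cst_seg p hc (d m) (d k) (d j) hk']
      · ring
      · by_cases h : d j ≤ d m
        · exact Or.inl h
        · exact Or.inr (hkmin j (by simpa using h))
    have h1 : 0 < (d k : ℝ) - d m := sub_pos.2 (by exact_mod_cast hk')
    have h2 := hmin k
    exact nonneg_of_mul_nonneg_right (by rw [← hseg]; linarith) h1
  · push Not at hex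
    refine Finset.sum_nonneg fun k _ => mul_nonneg (sig_nonneg P hPnn x hx k) ?_
    rw [if_pos (hex k)]
    exact hhc.le

lemma mono_max (F : ℤ → ℝ) (a : ℤ)
    (hF : ∀ s t : ℤ, s ≤ t → F (s + 1) - F s ≤ F (t + 1) - F t) (ha : F a ≤ F (a + 1)) :
    (∀ s t : ℤ, s ≤ t → F (max a s) ≤ F (max a t)) ∧
    (∀ s t : ℤ, s ≤ t → F (max a (s + 1)) - F (max a s) ≤ F (max a (t + 1)) - F (max a t)) := by
  have hstep : ∀ s, F (max a s) ≤ F (max a (s + 1)) := by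
    intro s
    by_cases h : a ≤ s
    · rw [max_eq_right h, max_eq_right (by omega)]
      have := hF a s h
      linarith
    · rw [max_eq_left (by omega), max_eq_left (by omega)]
  constructor
  · exact fun s t h => monotone_int_of_le_succ (f := fun s => F (max a s)) hstep h
  · intro s t h
    by_cases h1 : a ≤ s
    · rw [max_eq_right h1, max_eq_right (by omega : a ≤ s + 1), max_eq_right (by omega : a ≤ t),
        max_eq_right (by omega : a ≤ t + 1)]
      exact hF s t h
    · rw [max_eq_left (by omega : s ≤ a), max_eq_left (by omega : s + 1 ≤ a)]
      have := hstep t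
      linarith

/-- Proposition 3 and `v^U` as an upper bound: `v^U_n(x,s)` is constant
for `s ≤ s*(x)`, nondecreasing and convex in `s`, and dominates the optimal cost `v_n`. -/
theorem stmt10 {N M : ℕ} {Z : Type*} [Fintype Z] [Nonempty Z]
    (hN : 1 ≤ N) (hM : 1 ≤ M)
    (d : Fin M → ℤ) (hd : StrictMono d)
    (P : Fin M → Z → Matrix (Fin N) (Fin N) ℝ)
    (hPnn : ∀ k z i j, 0 ≤ P k z i j)
    (hPst : ∀ i : Fin N, ∑ k : Fin M, ∑ z : Z, ∑ j : Fin N, P k z i j = 1)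
    (p hc : ℝ) (hp : 0 < p) (hhc : 0 < hc)
    (β : ℝ) (hβ0 : 0 ≤ β) (hβ1 : β < 1) :
    ∀ (n : ℕ) (x : Fin N → ℝ), memX N x →
      -- (a)
      (∀ s : ℤ, s ≤ sStar P d p hc x →
        vUp P d p hc β n x s = vUp P d p hc β n x (sStar P d p hc x)) ∧
      -- (b)
      (∀ s s' : ℤ, s ≤ s' → vUp P d p hc β n x s ≤ vUp P d p hc β n x s') ∧
      (∀ s s' : ℤ, s ≤ s' →
        vUp P d p hc β n x (s + 1) - vUp P d p hc β n x s ≤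
          vUp P d p hc β n x (s' + 1) - vUp P d p hc β n x s') ∧
      -- (c)
      (∀ s : ℤ, vIter P d p hc β (fun y dd => y - dd) n x s ≤ vUp P d p hc β n x s) := by
  intro n
  induction n with
  | zero =>
    intro x _
    simp [vUp, vIter]
  | succ n ih =>
    intro x hx
    set a := sStar P d p hc x with ha
    set T : Fin M → Z → ℤ → ℝ := fun k z y => if sigz P k z x = 0 then 0
       else sigz P k z x * vUp P d p hc β n (lam P k z x) (y - d k) with hT
    set F : ℤ → ℝ := fun y => Lf P d p hc x (y : ℝ) + β * ∑ k, ∑ z, T k z y with hFdef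
    have hv : ∀ s, vUp P d p hc β (n + 1) x s = F (max a s) := fun s => by rw [vUp]
    have hTmono : ∀ y y' : ℤ, y ≤ y' → ∑ k, ∑ z, T k z y ≤ ∑ k, ∑ z, T k z y' := by
      intro y y' hy
      refine Finset.sum_le_sum fun k _ => Finset.sum_le_sum fun z _ => ?_
      simp only [hT]
      split_ifs with h0
      · exact le_rfl
      · exact mul_le_mul_of_nonneg_left
          ((ih _ (lam_mem P hPnn x hx k z h0)).2.1 _ _ (by omega)) (sigz_nonneg P hPnn x hx k z)
    have hTconv : ∀ y y' : ℤ, y ≤ y' →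
        (∑ k, ∑ z, T k z (y + 1)) - ∑ k, ∑ z, T k z y
          ≤ (∑ k, ∑ z, T k z (y' + 1)) - ∑ k, ∑ z, T k z y' := by
      intro y y' hy
      simp only [← Finset.sum_sub_distrib]
      refine Finset.sum_le_sum fun k _ => Finset.sum_le_sum fun z _ => ?_
      simp only [hT]
      split_ifs with h0
      · exact le_rfl
      · rw [← mul_sub, ← mul_sub]
        refine mul_le_mul_of_nonneg_left ?_ (sigz_nonneg P hPnn x hx k z)
        have := (ih _ (lam_mem P hPnn x hx k z h0)).2.2.1 (y - d k) (y' - d k) (by omega)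
        rwa [sub_add_eq_add_sub, sub_add_eq_add_sub] at this
    have hFconv : ∀ s t : ℤ, s ≤ t → F (s + 1) - F s ≤ F (t + 1) - F t := by
      intro s t hst
      have h1 := Lf_convex P d hPnn p hc hp hhc x hx s t hst
      have h2 := mul_le_mul_of_nonneg_left (hTconv s t hst) hβ0
      simp only [hFdef]
      rw [mul_sub, mul_sub] at h2
      linarith
    have hFa : F a ≤ F (a + 1) :=
      add_le_add (Lf_star P d hPnn p hc hhc hM x hx)
        (mul_le_mul_of_nonneg_left (hTmono a (a + 1) (by omega)) hβ0)
    obtain ⟨hm, hcv⟩ := mono_max F a hFconv hFa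
    simp only [hv]
    refine ⟨?_, hm, hcv, ?_⟩
    · intro s hs
      rw [max_eq_left hs, max_self]
    · intro s
      rw [vIter]
      refine csInf_le_of_le ?_ ⟨max a s, le_max_right _ _, rfl⟩ ?_
      · refine ⟨0, ?_⟩
        rintro r ⟨y, _, rfl⟩
        exact (vIter_nonneg P d hPnn p hc hp hhc β hβ0 _ n x hx 0).2 y
      · refine add_le_add le_rfl (mul_le_mul_of_nonneg_left ?_ hβ0)
        refine Finset.sum_le_sum fun k _ => Finset.sum_le_sum fun z _ => ?_
        simp only [hT]
        split_ifs with h0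
        · exact le_rfl
        · exact mul_le_mul_of_nonneg_left
            ((ih _ (lam_mem P hPnn x hx k z h0)).2.2.2 _) (sigz_nonneg P hPnn x hx k z)

end InvCtrl
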